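/- arXiv:1012.4984 — 7 statements merged into one kernel-verified Lean document; each statement's English description precedes it below -/
import Mathlib

section
/- Let A be a zero-cubed associative algebra over a field F. Then A*A is contained in the annihilator Ann(A); moreover, for any F-subspace X of A that is a complement of Ann(A) (i.e. IsCompl Ann(A) X, which exists since F is a field), denoting by π : A → A the linear projection onto X along Ann(A), one has x*y = (π x)*(π y) for all x, y ∈ A. Hence the multiplication of A is completely determined by the bilinear map f : X × X → Ann(A), f(x, x') = x*x'. -/
/-- The annihilator `Ann(A) = {x : x*A = 0 and A*x = 0}` of a (not necessarily
unital or associative) `F`-algebra given by a bilinear multiplication `mul`. -/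
def Annihilator (F A : Type*) [Field F] [AddCommGroup A] [Module F A]
    (mul : A →ₗ[F] A →ₗ[F] A) : Submodule F A where
  carrier := {x | ∀ a : A, mul x a = 0 ∧ mul a x = 0}
  add_mem' := by
    intro x y hx hy a
    constructor
    · simp [map_add, (hx a).1, (hy a).1]
    · simp [map_add, (hx a).2, (hy a).2]
  zero_mem' := by intro a; simp
  smul_mem' := by
    intro c x hx a
    constructor
    · simp [map_smul, (hx a).1]
    · simp [map_smul, (hx a).2]

/-- For a zero-cubed associative algebra `A` over a field `F`,
`A*A ⊆ Ann(A)`; a complement `X` of `Ann(A)` exists, and for any such complement,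
with `π` the projection onto `X` along `Ann(A)`, one has `x*y = (π x)*(π y)`,
so the multiplication is determined by the restriction of the multiplication
to `X × X` (a bilinear map `X × X → Ann(A)`). -/
theorem statement1 (F A : Type*) [Field F] [AddCommGroup A] [Module F A]
    (mul : A →ₗ[F] A →ₗ[F] A)
    (hassoc : ∀ a b c : A, mul (mul a b) c = mul a (mul b c))
    (hcube : ∀ a b c : A, mul (mul a b) c = 0) :
    (∀ a b : A, mul a b ∈ Annihilator F A mul) ∧
    (∃ X : Submodule F A, IsCompl (Annihilator F A mul) X) ∧
    (∀ X : Submodule F A, ∀ h : IsCompl (Annihilator F A mul) X,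
      ∀ x y : A,
        mul x y =
          mul (X.subtype (X.linearProjOfIsCompl (Annihilator F A mul) h.symm x))
              (X.subtype (X.linearProjOfIsCompl (Annihilator F A mul) h.symm y))) := by
  refine ⟨fun a b c => ⟨hcube a b c, by rw [← hassoc, hcube]⟩, Submodule.exists_isCompl _, ?_⟩
  intro X h x y
  have sub_mem (z : A) :
      z - X.subtype (X.projectionOnto (Annihilator F A mul) h.symm z) ∈
        Annihilator F A mul := by
    rw [← Submodule.projectionOnto_apply_eq_zero_iff h.symm, map_sub, sub_eq_zero]
    exact (Submodule.projectionOnto_apply_left h.symm _).symm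
  have hx := (sub_mem x y).1
  have hy := (sub_mem y (X.subtype (X.projectionOnto (Annihilator F A mul) h.symm x))).2
  rw [map_sub, LinearMap.sub_apply, sub_eq_zero] at hx
  rw [map_sub, sub_eq_zero] at hy
  exact hx.trans hy
end

section
/- Let F be a field and let (Z_A, X_A, f_A) and (Z_B, X_B, f_B) be triples consisting of F-vector spaces and F-bilinear maps f_A : X_A → X_A → Z_A, f_B : X_B → X_B → Z_B. Let A = Z_A × X_A and B = Z_B × X_B be the zero-cubed F-algebras with products (z,x)*(z',x') = (f_A x x', 0) and (z,x)*(z',x') = (f_B x x', 0) respectively, and assume that the annihilator of A equals Z_A × {0} and the annihilator of B equals Z_B × {0}. Then A and B are isomorphic as F-algebras if and only if there exist F-linear isomorphisms α : Z_A ≃ Z_B and β : X_A ≃ X_B such that f_B (β x) (β x') = α (f_A x x') for all x, x' ∈ X_A. -/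
namespace LinearEquiv

variable {R M N M' N' : Type*} [Ring R]
  [AddCommGroup M] [Module R M] [AddCommGroup N] [Module R N]
  [AddCommGroup M'] [Module R M'] [AddCommGroup N'] [Module R N']

/-- A linear equivalence of products that identifies the first factors restricts to an
equivalence of the first factors. -/
def prodFstRestrict (e : (M × N) ≃ₗ[R] M' × N')
    (h : ∀ p, (e p).2 = 0 ↔ p.2 = 0) : M ≃ₗ[R] M' where
  __ := LinearMap.fst R M' N' ∘ₗ e.toLinearMap ∘ₗ LinearMap.inl R M N
  invFun z := (e.symm (z, 0)).1
  left_inv z := by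
    have : ((e (z, 0)).1, (0 : N')) = e (z, 0) := Prod.ext rfl ((h (z, 0)).2 rfl).symm
    simp [this]
  right_inv z := by
    have : ((e.symm (z, 0)).1, (0 : N)) = e.symm (z, 0) :=
      Prod.ext rfl ((h _).1 (by simp)).symm
    simp [this]

/-- A linear equivalence of products that identifies the first factors induces an
equivalence of the second factors. -/
def prodSndInduced (e : (M × N) ≃ₗ[R] M' × N')
    (h : ∀ p, (e p).2 = 0 ↔ p.2 = 0) : N ≃ₗ[R] N' where
  __ := LinearMap.snd R M' N' ∘ₗ e.toLinearMap ∘ₗ LinearMap.inr R M N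
  invFun x := (e.symm (0, x)).2
  left_inv x := by
    have hp : ((0 : M'), (e (0, x)).2) = e (0, x) - ((e (0, x)).1, 0) := by ext <;> simp
    have hz : (e.symm ((e (0, x)).1, 0)).2 = 0 := (h _).1 (by simp)
    simp [hp, hz]
  right_inv x := by
    have hp : ((0 : M), (e.symm (0, x)).2) = e.symm (0, x) - ((e.symm (0, x)).1, 0) := by
      ext <;> simp
    have hz : (e ((e.symm (0, x)).1, 0)).2 = 0 := (h _).2 rfl
    simp [hp, hz]

end LinearEquiv

/-- Two zero-cubed algebras `A = Z_A × X_A` and `B = Z_B × X_B` built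
from bilinear maps `f_A`, `f_B` (with annihilators `Z_A × {0}`, `Z_B × {0}`) are
isomorphic as `F`-algebras iff there are linear isomorphisms `α : Z_A ≃ Z_B` and
`β : X_A ≃ X_B` with `f_B (β x) (β x') = α (f_A x x')` for all `x, x'`. -/
theorem statement2 (F ZA XA ZB XB : Type*) [Field F]
    [AddCommGroup ZA] [Module F ZA] [AddCommGroup XA] [Module F XA]
    [AddCommGroup ZB] [Module F ZB] [AddCommGroup XB] [Module F XB]
    (fA : XA →ₗ[F] XA →ₗ[F] ZA) (fB : XB →ₗ[F] XB →ₗ[F] ZB)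
    (mulA : ZA × XA → ZA × XA → ZA × XA)
    (mulB : ZB × XB → ZB × XB → ZB × XB)
    (hmulA : ∀ p q : ZA × XA, mulA p q = (fA p.2 q.2, 0))
    (hmulB : ∀ p q : ZB × XB, mulB p q = (fB p.2 q.2, 0))
    (hAnnA : ∀ p : ZA × XA, (∀ q : ZA × XA, mulA p q = 0 ∧ mulA q p = 0) ↔ p.2 = 0)
    (hAnnB : ∀ p : ZB × XB, (∀ q : ZB × XB, mulB p q = 0 ∧ mulB q p = 0) ↔ p.2 = 0) :
    (∃ e : (ZA × XA) ≃ₗ[F] ZB × XB, ∀ p q : ZA × XA, e (mulA p q) = mulB (e p) (e q)) ↔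
    (∃ (α : ZA ≃ₗ[F] ZB) (β : XA ≃ₗ[F] XB),
      ∀ x x' : XA, fB (β x) (β x') = α (fA x x')) := by
  constructor
  · rintro ⟨e, he⟩
    have h : ∀ p, (e p).2 = 0 ↔ p.2 = 0 := by
      intro p
      rw [← hAnnA, ← hAnnB, ← e.toEquiv.forall_congr_right]
      refine forall_congr' fun q => ?_
      change mulB (e p) (e q) = 0 ∧ mulB (e q) (e p) = 0 ↔ _
      rw [← he, ← he, e.map_eq_zero_iff, e.map_eq_zero_iff]
    refine ⟨e.prodFstRestrict h, e.prodSndInduced h, fun x x' => ?_⟩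
    have hmul := he (0, x) (0, x')
    rw [hmulA, hmulB] at hmul
    exact (congrArg Prod.fst hmul).symm
  · rintro ⟨α, β, h⟩
    exact ⟨α.prodCongr β, fun p q => by simp [hmulA, hmulB, h]⟩
end

section
/- Let A be a two-dimensional zero-cubed associative algebra over a field F. Then either A is trivial (a*b = 0 for all a, b ∈ A), or A is isomorphic as an F-algebra to F × F equipped with the multiplication (λ, μ)*(λ', μ') := (μμ', 0). -/
/-- Two linearly independent vectors span a two-dimensional space. -/
theorem exists_eq_smul_add_smul_of_finrank_eq_two {F A : Type*} [Field F] [AddCommGroup A]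
    [Module F A] (hdim : Module.finrank F A = 2) {u v : A} (h : LinearIndependent F ![u, v])
    (a : A) : ∃ x y : F, a = x • u + y • v := by
  have hspan := h.span_eq_top_of_card_eq_finrank (by simp [hdim])
  have ha : a ∈ Submodule.span F (Set.range ![u, v]) := hspan ▸ Submodule.mem_top
  rw [Matrix.range_cons_cons_empty, Submodule.mem_span_pair] at ha
  obtain ⟨x, y, hxy⟩ := ha
  exact ⟨x, y, hxy.symm⟩

/-- A nontrivial two-dimensional zero-cubed algebra has an element with nonzero square. -/
theorem exists_mul_self_ne_zero_of_finrank_eq_two {F A : Type*} [Field F] [AddCommGroup A]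
    [Module F A] (mul : A →ₗ[F] A →ₗ[F] A)
    (hleft : ∀ a b c : A, mul (mul a b) c = 0) (hright : ∀ a b c : A, mul a (mul b c) = 0)
    (hdim : Module.finrank F A = 2) {c d : A} (hcd : mul c d ≠ 0) : ∃ m, mul m m ≠ 0 := by
  by_contra! hsq
  have hind : LinearIndependent F ![c, d] := by
    rw [LinearIndependent.pair_iff]
    intro x y hxy
    have hx := congrArg (fun a => mul a d) hxy
    have hy := congrArg (mul c) hxy
    simp [hsq] at hx hy
    tauto
  obtain ⟨x, y, hxy⟩ := exists_eq_smul_add_smul_of_finrank_eq_two hdim hind (mul c d)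
  have hx := congrArg (fun a => mul a d) hxy.symm
  have hy := congrArg (mul c) hxy.symm
  simp [hsq, hleft, hright, hcd] at hx hy
  exact hcd (by simpa [hx, hy] using hxy)

/-- A two-dimensional zero-cubed associative algebra over a field `F`
is either trivial (all products vanish) or isomorphic as an `F`-algebra to `F × F`
with the multiplication `(λ, μ)*(λ', μ') = (μμ', 0)`. -/
theorem statement6 (F A : Type*) [Field F] [AddCommGroup A] [Module F A]
    (mul : A →ₗ[F] A →ₗ[F] A)
    (hassoc : ∀ a b c : A, mul (mul a b) c = mul a (mul b c))
    (hcube : ∀ a b c : A, mul (mul a b) c = 0)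
    (hdim : Module.finrank F A = 2) :
    (∀ a b : A, mul a b = 0) ∨
    (∃ e : A ≃ₗ[F] F × F, ∀ a b : A, e (mul a b) = ((e a).2 * (e b).2, 0)) := by
  have hright : ∀ a b c : A, mul a (mul b c) = 0 := fun a b c => by rw [← hassoc, hcube]
  by_cases htriv : ∀ a b : A, mul a b = 0
  · exact Or.inl htriv
  right
  push Not at htriv
  obtain ⟨c, d, hcd⟩ := htriv
  obtain ⟨m, hm⟩ := exists_mul_self_ne_zero_of_finrank_eq_two mul hcube hright hdim hcd
  have hind : LinearIndependent F ![mul m m, m] := by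
    rw [LinearIndependent.pair_iff]
    intro x y hxy
    have hy := congrArg (mul m) hxy
    simp [hright, hm] at hy
    simpa [hy, hm] using hxy
  let e := (basisOfLinearIndependentOfCardEqFinrank hind (by simp [hdim])).equivFun.trans
    (LinearEquiv.finTwoArrow F F)
  have hsymm : ∀ p : F × F, e.symm p = p.1 • mul m m + p.2 • m := fun p => by
    simp [e, Module.Basis.equivFun_symm_apply]
  refine ⟨e, fun a b => ?_⟩
  obtain ⟨p, rfl⟩ := e.symm.surjective a
  obtain ⟨q, rfl⟩ := e.symm.surjective b
  apply e.symm.injective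
  simp only [LinearEquiv.symm_apply_apply, LinearEquiv.apply_symm_apply]
  simp [hsymm, hcube, hright, smul_smul]
end

section
/- Let A be an associative algebra over a field F (multiplication written by juxtaposition) and let d : A → A be an F-linear map satisfying d(xy) = d(x)y + x d(y) for all x, y ∈ A and d(d(x)) = 0 for all x ∈ A. Then the products x ⊣ y := x d(y) and x ⊢ y := d(x) y make A into an associative dialgebra: both products are associative and satisfy (x⊣y)⊣z = x⊣(y⊢z), (x⊢y)⊣z = x⊢(y⊣z), (x⊣y)⊢z = x⊢(y⊢z) for all x, y, z ∈ A. -/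
/-- If `A` is an associative `F`-algebra and `d : A → A` is an
`F`-linear derivation with `d ∘ d = 0`, then `x ⊣ y := x·d(y)` and
`x ⊢ y := d(x)·y` make `A` into an associative dialgebra: both products are
associative and the three dialgebra identities hold. -/
theorem statement8 (F A : Type*) [Field F] [NonUnitalRing A] [Module F A]
    [SMulCommClass F A A] [IsScalarTower F A A]
    (d : A →ₗ[F] A)
    (hder : ∀ x y : A, d (x * y) = d x * y + x * d y)
    (hsq : ∀ x : A, d (d x) = 0) :
    let l : A → A → A := fun x y => x * d y
    let r : A → A → A := fun x y => d x * y
    (∀ x y z : A, l (l x y) z = l x (l y z)) ∧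
    (∀ x y z : A, r (r x y) z = r x (r y z)) ∧
    (∀ x y z : A, l (l x y) z = l x (r y z)) ∧
    (∀ x y z : A, l (r x y) z = r x (l y z)) ∧
    (∀ x y z : A, r (l x y) z = r x (r y z)) := by
  refine ⟨?_, ?_, ?_, ?_, ?_⟩ <;> intro x y z <;> simp [hder, hsq, mul_assoc]
end

section
/- Let A be an associative dialgebra over a field F with products ⊣ and ⊢. If (A, ⊢) is a simple associative algebra (i.e. A ⊢ A ≠ 0 and the only F-subspaces I of A with a⊢i ∈ I and i⊢a ∈ I for all a ∈ A, i ∈ I are 0 and A), or if (A, ⊣) is a simple associative algebra in the analogous sense, then the two products coincide: x ⊣ y = x ⊢ y for all x, y ∈ A; hence A is the dialgebra associated to a simple associative algebra, and in particular A is both ⊣-simple and ⊢-simple. -/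
/-- A two-sided ideal of the (not necessarily unital) algebra `(A, m)`. -/
def IsTwoSidedIdeal (F A : Type*) [Field F] [AddCommGroup A] [Module F A]
    (m : A →ₗ[F] A →ₗ[F] A) (I : Submodule F A) : Prop :=
  ∀ a : A, ∀ i ∈ I, m a i ∈ I ∧ m i a ∈ I

/-- Simplicity of the (not necessarily unital) associative algebra `(A, m)`:
`A·A ≠ 0` and the only two-sided ideals are `0` and `A`. -/
def IsSimpleMul (F A : Type*) [Field F] [AddCommGroup A] [Module F A]
    (m : A →ₗ[F] A →ₗ[F] A) : Prop :=
  (∃ a b : A, m a b ≠ 0) ∧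
  ∀ I : Submodule F A, IsTwoSidedIdeal F A m I → I = ⊥ ∨ I = ⊤

theorem IsSimpleMul.ker_eq_bot {F A : Type*} [Field F] [AddCommGroup A] [Module F A]
    {m : A →ₗ[F] A →ₗ[F] A} (hm : ∀ x y z : A, m (m x y) z = m x (m y z))
    (hs : IsSimpleMul F A m) : LinearMap.ker m = ⊥ := by
  obtain ⟨⟨a, b, hab⟩, hI⟩ := hs
  refine (hI _ ?_).resolve_right ?_
  · intro a i hi
    have hi' : m i = 0 := hi
    exact ⟨LinearMap.ext fun z => by simp [hm, hi'], by simp [hi']⟩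
  · intro h
    exact hab (by simp [LinearMap.ker_eq_top.mp h])

theorem IsSimpleMul.ker_flip_eq_bot {F A : Type*} [Field F] [AddCommGroup A] [Module F A]
    {m : A →ₗ[F] A →ₗ[F] A} (hm : ∀ x y z : A, m (m x y) z = m x (m y z))
    (hs : IsSimpleMul F A m) : LinearMap.ker m.flip = ⊥ := by
  obtain ⟨⟨a, b, hab⟩, hI⟩ := hs
  refine (hI _ ?_).resolve_right ?_
  · intro a i hi
    have hi' : ∀ z, m z i = 0 := fun z => LinearMap.congr_fun hi z
    exact ⟨by simp [hi'], LinearMap.ext fun z => by simp [← hm, hi']⟩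
  · intro h
    exact hab (by rw [← LinearMap.flip_apply, LinearMap.ker_eq_top.mp h]; rfl)

/-- If `(A, ⊣, ⊢)` is an associative dialgebra over a field `F`
and `(A, ⊢)` or `(A, ⊣)` is a simple associative algebra, then the two products
coincide, so `A` is the dialgebra associated to a simple associative algebra and
in particular `A` is both `⊣`-simple and `⊢`-simple.
Here `l x y = x ⊣ y` and `r x y = x ⊢ y`. -/
theorem statement16 (F A : Type*) [Field F] [AddCommGroup A] [Module F A]
    (l r : A →ₗ[F] A →ₗ[F] A)
    (hl : ∀ x y z : A, l (l x y) z = l x (l y z))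
    (hr : ∀ x y z : A, r (r x y) z = r x (r y z))
    (h1 : ∀ x y z : A, l (l x y) z = l x (r y z))
    (h2 : ∀ x y z : A, l (r x y) z = r x (l y z))
    (h3 : ∀ x y z : A, r (l x y) z = r x (r y z))
    (hsimp : IsSimpleMul F A r ∨ IsSimpleMul F A l) :
    (∀ x y : A, l x y = r x y) ∧ IsSimpleMul F A l ∧ IsSimpleMul F A r := by
  have heq : l = r := by
    ext x y
    rcases hsimp with hs | hs
    · refine LinearMap.ker_eq_bot.mp (hs.ker_eq_bot hr) (LinearMap.ext fun z => ?_)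
      rw [h3, hr]
    · refine LinearMap.ker_eq_bot.mp (hs.ker_flip_eq_bot hl) (LinearMap.ext fun z => ?_)
      rw [LinearMap.flip_apply, LinearMap.flip_apply, ← hl, h1]
  subst heq
  have hs : IsSimpleMul F A l := hsimp.elim id id
  exact ⟨fun _ _ => rfl, hs, hs⟩
end

section
/- Let A be an associative dialgebra over a field F with products ⊣ and ⊢. If (A, ⊢) is semiprime (every two-sided ideal I of (A,⊢) with I ⊢ I = 0 is zero), or if (A, ⊣) is semiprime (every two-sided ideal I of (A,⊣) with I ⊣ I = 0 is zero), then the two products coincide: x ⊣ y = x ⊢ y for all x, y ∈ A, so A is the dialgebra associated to a semiprime associative algebra. In particular the same conclusion holds when (A,⊢) or (A,⊣) is prime or primitive. -/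
/-- Semiprimeness of `(A, m)`: every two-sided ideal `I` with `I·I = 0` is zero. -/
def IsSemiprimeMul (F A : Type*) [Field F] [AddCommGroup A] [Module F A]
    (m : A →ₗ[F] A →ₗ[F] A) : Prop :=
  ∀ I : Submodule F A, IsTwoSidedIdeal F A m I →
    (∀ x ∈ I, ∀ y ∈ I, m x y = 0) → I = ⊥

/-- Primeness of `(A, m)`: `A ≠ 0` and for two-sided ideals `I`, `J` with
`I·J = 0` one has `I = 0` or `J = 0`. -/
def IsPrimeMul (F A : Type*) [Field F] [AddCommGroup A] [Module F A]
    (m : A →ₗ[F] A →ₗ[F] A) : Prop :=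
  (∃ a : A, a ≠ 0) ∧
  ∀ I J : Submodule F A, IsTwoSidedIdeal F A m I → IsTwoSidedIdeal F A m J →
    (∀ x ∈ I, ∀ y ∈ J, m x y = 0) → I = ⊥ ∨ J = ⊥

/-- Primitivity of `(A, m)`: existence of a faithful simple left `A`-module. -/
def IsPrimitiveMul (F A : Type*) [Field F] [AddCommGroup A] [Module F A]
    (m : A →ₗ[F] A →ₗ[F] A) : Prop :=
  ∃ (M : Type) (_ : AddCommGroup M) (_ : Module F M)
    (act : A →ₗ[F] M →ₗ[F] M),
      (∀ (a b : A) (x : M), act (m a b) x = act a (act b x)) ∧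
      (∀ a : A, (∀ x : M, act a x = 0) → a = 0) ∧
      (∃ (a : A) (x : M), act a x ≠ 0) ∧
      (∀ N : Submodule F M, (∀ a : A, ∀ n ∈ N, act a n ∈ N) → N = ⊥ ∨ N = ⊤)

section Semiprime

variable {F A : Type*} [Field F] [AddCommGroup A] [Module F A] {m : A →ₗ[F] A →ₗ[F] A}

theorem IsSemiprimeMul.eq_zero_of_mul_right (h : IsSemiprimeMul F A m)
    (assoc : ∀ x y z : A, m (m x y) z = m x (m y z)) {d : A} (hd : ∀ z : A, m d z = 0) :
    d = 0 := by
  have hbot : LinearMap.ker m = ⊥ := by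
    refine h _ (fun a i hi => ?_) (fun x hx y _ => ?_)
    · rw [LinearMap.mem_ker] at hi
      constructor <;> ext z <;> simp [assoc, hi]
    · rw [LinearMap.mem_ker] at hx
      simp [hx]
  have : d ∈ LinearMap.ker m := LinearMap.ext hd
  simpa [hbot] using this

theorem IsSemiprimeMul.flip (h : IsSemiprimeMul F A m) : IsSemiprimeMul F A m.flip :=
  fun I hI hsq => h I (fun a i hi => (hI a i hi).symm) fun x hx y hy => hsq y hy x hx

theorem IsPrimeMul.isSemiprimeMul (h : IsPrimeMul F A m) : IsSemiprimeMul F A m :=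
  fun I hI hsq => (h.2 I I hI hI hsq).elim id id

theorem IsPrimitiveMul.isSemiprimeMul (h : IsPrimitiveMul F A m) : IsSemiprimeMul F A m := by
  obtain ⟨M, _, _, act, hact, faithful, -, simple⟩ := h
  intro I hI hsq
  let N : Submodule F M := ⨅ i ∈ I, LinearMap.ker (act i)
  have mem_N (x : M) : x ∈ N ↔ ∀ i ∈ I, act i x = 0 := by simp [N]
  have hN : ∀ a : A, ∀ n ∈ N, act a n ∈ N := fun a n hn => (mem_N _).2 fun i hi => by
    rw [← hact]
    exact (mem_N n).1 hn _ (hI a i hi).2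
  refine (Submodule.eq_bot_iff I).2 fun i hi => faithful i fun x => ?_
  rcases simple N hN with h | h
  · have hx : act i x ∈ N := (mem_N _).2 fun j hj => by
      rw [← hact, hsq j hj i hi, map_zero, LinearMap.zero_apply]
    simpa [h] using hx
  · exact (mem_N x).1 (h ▸ Submodule.mem_top) i hi

end Semiprime

/-- If `(A, ⊣, ⊢)` is an associative dialgebra over a field `F`
and `(A, ⊢)` or `(A, ⊣)` is semiprime, then the two products coincide, so `A`
is the dialgebra associated to a semiprime associative algebra; in particular
the same conclusion holds when `(A, ⊢)` or `(A, ⊣)` is prime or primitive.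
Here `l x y = x ⊣ y` and `r x y = x ⊢ y`. -/
theorem statement17 (F A : Type*) [Field F] [AddCommGroup A] [Module F A]
    (l r : A →ₗ[F] A →ₗ[F] A)
    (hl : ∀ x y z : A, l (l x y) z = l x (l y z))
    (hr : ∀ x y z : A, r (r x y) z = r x (r y z))
    (h1 : ∀ x y z : A, l (l x y) z = l x (r y z))
    (h2 : ∀ x y z : A, l (r x y) z = r x (l y z))
    (h3 : ∀ x y z : A, r (l x y) z = r x (r y z))
    (hP : (IsSemiprimeMul F A r ∨ IsSemiprimeMul F A l) ∨
          (IsPrimeMul F A r ∨ IsPrimeMul F A l) ∨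
          (IsPrimitiveMul F A r ∨ IsPrimitiveMul F A l)) :
    (∀ x y : A, l x y = r x y) ∧
    (IsSemiprimeMul F A r ∨ IsSemiprimeMul F A l →
      IsSemiprimeMul F A l ∧ IsSemiprimeMul F A r) := by
  have hS : IsSemiprimeMul F A r ∨ IsSemiprimeMul F A l := by
    rcases hP with h | h | h
    · exact h
    · exact h.imp (·.isSemiprimeMul) (·.isSemiprimeMul)
    · exact h.imp (·.isSemiprimeMul) (·.isSemiprimeMul)
  have hlr : l = r := by
    ext x y
    refine sub_eq_zero.1 ?_
    rcases hS with h | h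
    · refine h.eq_zero_of_mul_right hr fun z => ?_
      rw [map_sub, LinearMap.sub_apply, h3, hr, sub_self]
    · refine h.flip.eq_zero_of_mul_right (fun a b c => (hl c b a).symm) fun z => ?_
      rw [LinearMap.flip_apply, map_sub, ← hl, ← h1, sub_self]
  subst hlr
  exact ⟨fun _ _ => rfl, fun h => ⟨h.elim id id, h.elim id id⟩⟩
end

section
/- Let F be a field and for k ∈ F, k ≠ 0, let II_k denote the associative dialgebra on F² with products (a,b) ⊣ (c,d) := (bd, 0) and (a,b) ⊢ (c,d) := (k·bd, 0). For nonzero k, k' ∈ F, the dialgebras II_k and II_{k'} are isomorphic (i.e. there is an F-linear bijection f : F² → F² with f(x⊣y) = f(x) ⊣' f(y) and f(x⊢y) = f(x) ⊢' f(y) for all x, y, where ⊣', ⊢' are the products of II_{k'}) if and only if k = k'. -/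
/-- For a field `F` and nonzero `k, k' ∈ F`, the associative
dialgebras `II_k` and `II_{k'}` on `F²`, with products
`(a,b) ⊣ (c,d) = (bd, 0)` and `(a,b) ⊢ (c,d) = (k·bd, 0)` (resp. with `k'`),
are isomorphic iff `k = k'`. -/
theorem statement18 (F : Type*) [Field F] (k k' : F) (hk : k ≠ 0) (hk' : k' ≠ 0) :
    (∃ f : (F × F) ≃ₗ[F] F × F,
      ∀ x y : F × F,
        f ((x.2 * y.2, 0) : F × F) = ((f x).2 * (f y).2, 0) ∧
        f ((k * (x.2 * y.2), 0) : F × F) = (k' * ((f x).2 * (f y).2), 0)) ↔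
    k = k' := by
  constructor
  · rintro ⟨f, hf⟩
    obtain ⟨h₁, h₂⟩ := hf (0, 1) (0, 1)
    simp only [mul_one] at h₁ h₂
    set c := (f (0, 1)).2 * (f (0, 1)).2
    have hc : c ≠ 0 := by
      intro hc
      rw [hc] at h₁
      have h : ((1, 0) : F × F) = 0 := f.map_eq_zero_iff.mp h₁
      exact one_ne_zero (congrArg Prod.fst h)
    have hsmul : ((k, 0) : F × F) = k • (1, 0) := by simp
    rw [hsmul, map_smul, h₁] at h₂
    exact mul_right_cancel₀ hc (congrArg Prod.fst h₂)
  · rintro rfl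
    exact ⟨LinearEquiv.refl F (F × F), fun x y => ⟨rfl, rfl⟩⟩
end
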